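/- For all integers ν ≥ 1, 0 ≤ s, b ≤ ν, and L ≥ 2, the following identity of polynomials in q holds: G^ν_{0,L}(s,b,q) = F^ν_{ν−s,ν−b}(L,q). -/

import Mathlib

open scoped Classical

noncomputable section

/-- The q-Pochhammer symbol `(q)_n = ∏_{j=1}^n (1 - q^j)`. -/
def qP {F : Type*} [Field F] (q : F) (n : ℕ) : F :=
  ∏ j ∈ Finset.range n, (1 - q ^ (j + 1))

/-- The q-binomial coefficient `[N choose k]_q = (q)_N / ((q)_k (q)_{N-k})`
for `0 ≤ k ≤ N`, and `0` otherwise. -/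
def qB {F : Type*} [Field F] (q : F) (N k : ℤ) : F :=
  if 0 ≤ k ∧ k ≤ N then qP q N.toNat / (qP q k.toNat * qP q (N - k).toNat) else 0

/-- `NN n i = N_i = n_i + n_{i+1} + ⋯ + n_ν` (indices 1-based; `n ⟨k⟩` is `n_{k+1}`). -/
def NN {ν : ℕ} (n : Fin ν → ℕ) (i : ℕ) : ℕ :=
  ∑ k : Fin ν, if i ≤ (k : ℕ) + 1 then n k else 0

/-- `α_{i,s} = max(0, i - s)`. -/
def alph (i s : ℕ) : ℤ := max 0 ((i : ℤ) - s)

/-- The exponent `N_1² + ⋯ + N_ν² + N_{s+1} + ⋯ + N_ν`. -/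
def expAG (ν s : ℕ) (nn : Fin ν → ℕ) : ℕ :=
  (∑ i ∈ Finset.Icc 1 ν, (NN nn i) ^ 2) + ∑ i ∈ Finset.Icc (s + 1) ν, NN nn i

/-- The polynomial `B^ν_{s,b}(L,q)` of Foda–Quano–Kirillov type. -/
def B {F : Type*} [Field F] (ν : ℕ) (s b : ℤ) (L : ℕ) (q : F) : F :=
  ∑ᶠ j : ℤ,
    (q ^ (j * ((2 * j + 1) * (2 * (ν : ℤ) + 3) - 2 * s)) *
        qB q (L : ℤ) (((L : ℤ) + b - s) / 2 + j * (2 * (ν : ℤ) + 3)) -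
      q ^ ((2 * j + 1) * ((2 * (ν : ℤ) + 3) * j + s)) *
        qB q (L : ℤ) (((L : ℤ) + b + s) / 2 + j * (2 * (ν : ℤ) + 3)))

/-- `jjf j l = j_l` for `1 ≤ l ≤ ν` (and junk value `0` otherwise). -/
def jjf {ν : ℕ} (j : Fin ν → ℕ) (l : ℕ) : ℤ :=
  if h : l - 1 < ν then (j ⟨l - 1, h⟩ : ℤ) else 0

/-- The q-multinomial coefficient `[L choose a]^(p)_ν`. -/
def qMulti {F : Type*} [Field F] (ν L : ℕ) (a : ℤ) (p : ℕ) (q : F) : F :=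
  ∑ᶠ j : Fin ν → ℕ,
    if (∑ l, (j l : ℤ)) = a then
      q ^ ((∑ l ∈ Finset.Icc 2 ν, jjf j (l - 1) * ((L : ℤ) - jjf j l)) -
            ∑ l ∈ Finset.Icc 1 p, jjf j l) *
        qB q (L : ℤ) (jjf j ν) * ∏ l ∈ Finset.Icc 2 ν, qB q (jjf j l) (jjf j (l - 1))
    else 0

/-- The polynomial `W^ν_{s,b}(L,q)` of Warnaar type. -/
def W {F : Type*} [Field F] (ν : ℕ) (s : ℤ) (b L : ℕ) (q : F) : F :=
  ∑ᶠ j : ℤ,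
    (q ^ (j * ((2 * j + 1) * (2 * (ν : ℤ) + 3) - 2 * s)) *
        qMulti ν L (((ν : ℤ) * ((L : ℤ) + 1) - s - b + 1) / 2 + (2 * (ν : ℤ) + 3) * j) b q -
      q ^ ((2 * j + 1) * ((2 * (ν : ℤ) + 3) * j + s)) *
        qMulti ν L (((ν : ℤ) * ((L : ℤ) + 1) + s - b + 1) / 2 + (2 * (ν : ℤ) + 3) * j) b q)

/-! ### Bressoud lattice paths -/

/-- Step values: `0 ↦ NE (+1)`, `1 ↦ SE (−1)`, `2 ↦ horizontal (0)`. -/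
def stepVal : Fin 3 → ℤ := ![1, -1, 0]

/-- Height of the path after `k` steps, starting at height `s`. -/
def hts (s : ℤ) {n : ℕ} (d : Fin n → Fin 3) (k : ℕ) : ℤ :=
  s + ∑ i ∈ Finset.range k, if h : i < n then stepVal (d ⟨i, h⟩) else 0

/-- The vertex `k` is a peak: it is preceded by a NE step and followed by a SE step. -/
def IsPeak {n : ℕ} (d : Fin n → Fin 3) (k : ℕ) : Prop :=
  ∃ hk : k < n, 1 ≤ k ∧ d ⟨k - 1, Nat.lt_of_le_of_lt (Nat.sub_le k 1) hk⟩ = 0 ∧ d ⟨k, hk⟩ = 1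

/-- `d` encodes a Bressoud path from height `s` to height `b` whose peaks have height `≤ ν`:
SE steps only from positive height, horizontal steps only on the x-axis. -/
def ValidPath (ν : ℕ) (s b : ℤ) {n : ℕ} (d : Fin n → Fin 3) : Prop :=
  hts s d n = b ∧
    (∀ k : Fin n, (d k = 1 → 0 < hts s d (k : ℕ)) ∧ (d k = 2 → hts s d (k : ℕ) = 0)) ∧
    (∀ k : ℕ, IsPeak d k → hts s d k ≤ (ν : ℤ))

/-- The weight of a Bressoud path starting at x-coordinate `M`:
the sum of the x-coordinates of its peaks. -/
def pwt (M : ℤ) {n : ℕ} (d : Fin n → Fin 3) : ℤ :=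
  ∑ k ∈ Finset.range (n + 1), if IsPeak d k then M + (k : ℤ) else 0

/-- `C^ν_{M,L}(s,b,q)`: the weighted count of Bressoud paths from `(M,s)` to `(L,b)`
with no peak higher than `ν`. -/
def Cpoly {F : Type*} [Field F] (ν : ℕ) (M L : ℤ) (s b : ℕ) (q : F) : F :=
  ∑ d ∈ Finset.univ.filter (fun d : Fin (L - M).toNat → Fin 3 => ValidPath ν (s : ℤ) (b : ℤ) d),
    q ^ pwt M d

/-- `t` is an admissible relative height for the peak at vertex `k`. -/
def RelProp (s : ℤ) {n : ℕ} (d : Fin n → Fin 3) (k t : ℕ) : Prop :=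
  0 < t ∧ ∃ k' k'' : ℕ, k' < k ∧ k < k'' ∧ k'' ≤ n ∧
    hts s d k' = hts s d k - t ∧ hts s d k'' = hts s d k - t ∧
    ∀ m : ℕ, k' < m → m < k'' → IsPeak d m →
      hts s d m ≤ hts s d k ∧ (hts s d m = hts s d k → k ≤ m)

/-- The relative height of the peak at vertex `k`: the largest `t` with `RelProp`. -/
def relHt (ν : ℕ) (s : ℤ) {n : ℕ} (d : Fin n → Fin 3) (k : ℕ) : ℕ :=
  Nat.findGreatest (RelProp s d k) (ν + n)

/-- `P^ν_{M,L}(s,b,n)`: Bressoud paths from `(M,s)` to `(L,b)`, peaks of height at most `ν`,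
with exactly `nn j` peaks of relative height `j+1`. -/
def Pset (ν : ℕ) (M L : ℤ) (s b : ℤ) (nn : Fin ν → ℕ) : Finset (Fin (L - M).toNat → Fin 3) :=
  Finset.univ.filter (fun d => ValidPath ν s b d ∧
    ∀ j : Fin ν, ((Finset.range ((L - M).toNat + 1)).filter
      (fun k => IsPeak d k ∧ relHt ν s d k = (j : ℕ) + 1)).card = nn j)

/-! ### Gordon lattice paths -/

/-- `f` encodes a Gordon path of length `n` from height `s` to height `b`:
`f 0 = s`, `f n = b`, adjacent frequencies sum to at most `ν`; values beyond `n` are `0`. -/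
def IsGordon (ν n s b : ℕ) (f : ℕ → ℕ) : Prop :=
  f 0 = s ∧ f n = b ∧ (∀ k, k < n → f k + f (k + 1) ≤ ν) ∧ (∀ k, n < k → f k = 0)

/-- The weight `Σ_{j=M+1}^{L-1} j f_j` of a Gordon path starting at x-coordinate `M`. -/
def gwt (M : ℤ) (n : ℕ) (f : ℕ → ℕ) : ℤ :=
  ∑ k ∈ Finset.Ioo 0 n, (M + (k : ℤ)) * (f k : ℤ)

/-- `G^ν_{M,L}(s,b,q)`: the weighted count of Gordon paths from `(M,s)` to `(L,b)`. -/
def G {F : Type*} [Field F] (ν : ℕ) (M L : ℤ) (s b : ℕ) (q : F) : F :=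
  ∑ᶠ f : ℕ → ℕ, if IsGordon ν (L - M).toNat s b f then q ^ gwt M (L - M).toNat f else 0

/-- `F^ν_{s,b}(L,q)` of (2.21). -/
def Fpoly {F : Type*} [Field F] (ν s b L : ℕ) (q : F) : F :=
  ∑ᶠ nn : Fin ν → ℕ, q ^ expAG ν s nn *
    ∏ i : Fin ν, qB q ((nn i : ℤ) + ((i : ℕ) + 1) * (L : ℤ) -
      2 * (∑ l ∈ Finset.Icc 1 ((i : ℕ) + 1), (NN nn l : ℤ)) -
      alph ((i : ℕ) + 1) s - alph ((i : ℕ) + 1) b) (nn i)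

/-- The left-hand side of (4.2): `F` with the extra `−M(N_1+⋯+N_ν)` in the exponent. -/
def FpolyM {F : Type*} [Field F] (ν s b L M : ℕ) (q : F) : F :=
  ∑ᶠ nn : Fin ν → ℕ,
    q ^ ((expAG ν s nn : ℤ) - (M : ℤ) * ∑ i ∈ Finset.Icc 1 ν, (NN nn i : ℤ)) *
    ∏ i : Fin ν, qB q ((nn i : ℤ) + ((i : ℕ) + 1) * (L : ℤ) -
      2 * (∑ l ∈ Finset.Icc 1 ((i : ℕ) + 1), (NN nn l : ℤ)) -
      alph ((i : ℕ) + 1) s - alph ((i : ℕ) + 1) b) (nn i)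


abbrev K : Type := RatFunc ℚ



/-! ### Refined Gordon polynomials (coefficient of `z^m`) -/

def gq {F : Type*} [Field F] (q : F) (ν : ℕ) (s : ℕ) : ℕ → ℕ → ℤ → F
  | 0, b, m => if s = 0 ∧ b = 0 ∧ m = 0 then 1 else 0
  | 1, b, m => if s + b ≤ ν ∧ m = 0 then 1 else 0
  | (L + 2), b, m => ∑ k ∈ Finset.range (ν + 1 - b),
      q ^ ((L + 1) * k) * gq q ν s (L + 1) k (m - k)

lemma gq_rec {F : Type*} [Field F] (q : F) (ν s L b : ℕ) (hL : 1 ≤ L) (hb : b ≤ ν) (m : ℤ) :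
    gq q ν s (L + 1) b m = gq q ν s (L + 1) (b + 1) m +
      q ^ (L * (ν - b)) * gq q ν s L (ν - b) (m - ((ν - b : ℕ) : ℤ)) := by
  obtain ⟨l, rfl⟩ : ∃ l, L = l + 1 := ⟨L - 1, by omega⟩
  have h1 : ν + 1 - b = (ν - b) + 1 := by omega
  have h2 : ν + 1 - (b + 1) = ν - b := by omega
  simp only [gq]
  rw [h1, h2, Finset.sum_range_succ]

lemma gq_big {F : Type*} [Field F] (q : F) (ν s L : ℕ) (m : ℤ) :
    gq q ν s L (ν + 1) m = 0 := by
  match L with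
  | 0 => simp [gq]
  | 1 => simp only [gq]; rw [if_neg]; omega
  | (l + 2) => simp [gq]

lemma gq_supp {F : Type*} [Field F] (q : F) (ν s L : ℕ) :
    ∀ (b : ℕ) (m : ℤ), 1 ≤ L → gq q ν s L b m ≠ 0 →
      0 ≤ m ∧ 2 * m ≤ (ν : ℤ) * L - s - b := by
  induction L with
  | zero => intro b m h; omega
  | succ L ih =>
    intro b m _ h
    match L with
    | 0 =>
      simp only [gq] at h
      have : s + b ≤ ν ∧ m = 0 := by
        by_contra h'
        exact h (if_neg h')
      push_cast
      constructor <;> [omega; (ring_nf; omega)]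
    | (l + 1) =>
      simp only [gq] at h
      obtain ⟨k, hk, hne⟩ := Finset.exists_ne_zero_of_sum_ne_zero h
      have := ih k (m - k) (by omega) (right_ne_zero_of_mul hne)
      rw [Finset.mem_range] at hk
      push_cast at this ⊢
      constructor
      · omega
      · have h3 := this.2
        have : (k : ℤ) + b ≤ ν := by omega
        nlinarith

lemma qP_succ {F : Type*} [Field F] (q : F) (n : ℕ) :
    qP q (n + 1) = qP q n * (1 - q ^ (n + 1)) := by
  simp [qP, Finset.prod_range_succ]

lemma qB_zero {F : Type*} [Field F] {q : F} (hq : ∀ n, qP q n ≠ 0) (T : ℤ) :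
    qB q T 0 = if 0 ≤ T then 1 else 0 := by
  unfold qB
  have h0 : qP q 0 = 1 := by simp [qP]
  by_cases h : 0 ≤ T
  · simp [h, h0, hq]
  · simp [h]

lemma qB_neg {F : Type*} [Field F] {q : F} (T n : ℤ) (h : T < n) : qB q T n = 0 := by
  unfold qB; rw [if_neg]; omega

lemma qB_self {F : Type*} [Field F] {q : F} (hq : ∀ n, qP q n ≠ 0) (n : ℕ) :
    qB q n n = 1 := by
  unfold qB
  have h0 : qP q 0 = 1 := by simp [qP]
  simp [h0, hq]

lemma qB_pascal {F : Type*} [Field F] {q : F} (hq : ∀ n, qP q n ≠ 0)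
    (T : ℤ) (n : ℕ) (h : ¬ (T = 0 ∧ n = 0)) :
    qB q T n = qB q (T - 1) n + q ^ (T - n) * qB q (T - 1) ((n : ℤ) - 1) := by
  rcases Nat.eq_zero_or_pos n with rfl | hn
  · have : qB q (T - 1) (((0 : ℕ) : ℤ) - 1) = 0 := by
      unfold qB; rw [if_neg]; omega
    rw [this]
    have h' : T ≠ 0 := by omega
    simp only [Nat.cast_zero, qB_zero hq]
    by_cases h1 : 0 ≤ T
    · rw [if_pos h1, if_pos (by omega)]; ring
    · rw [if_neg h1, if_neg (by omega)]; ring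
  · rcases lt_trichotomy T n with h1 | h1 | h1
    · rw [qB_neg _ _ h1, qB_neg _ _ (by omega), qB_neg _ _ (by omega)]; ring
    · subst h1
      have : ((n : ℤ) - 1) = ((n - 1 : ℕ) : ℤ) := by omega
      rw [qB_self hq, qB_neg _ _ (by omega), this, qB_self hq]; simp
    · obtain ⟨k, rfl⟩ : ∃ k, n = k + 1 := ⟨n - 1, by omega⟩
      obtain ⟨d, rfl⟩ : ∃ d : ℕ, T = ((k + 1 + (d + 1) : ℕ) : ℤ) :=
        ⟨(T - k - 2).toNat, by omega⟩
      unfold qB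
      rw [if_pos (by omega), if_pos (by omega), if_pos (by omega)]
      have e1 : (((k + 1 + (d + 1) : ℕ) : ℤ)).toNat = k + d + 1 + 1 := by omega
      have e2 : (((k + 1 : ℕ) : ℤ)).toNat = k + 1 := by omega
      have e3 : (((k + 1 + (d + 1) : ℕ) : ℤ) - ((k + 1 : ℕ) : ℤ)) = ((d + 1 : ℕ) : ℤ) := by
        push_cast; ring
      have e4 : (((k + 1 + (d + 1) : ℕ) : ℤ) - 1).toNat = k + d + 1 := by omega
      have e5 : (((k + 1 + (d + 1) : ℕ) : ℤ) - 1 - ((k + 1 : ℕ) : ℤ)).toNat = d := by omega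
      have e6 : (((k + 1 : ℕ) : ℤ) - 1).toNat = k := by omega
      have e7 : (((k + 1 + (d + 1) : ℕ) : ℤ) - 1 - (((k + 1 : ℕ) : ℤ) - 1)).toNat = d + 1 := by
        omega
      rw [e5, e7, e3, e4, e1, e2, e6, zpow_natCast, Int.toNat_natCast]
      have hk := hq k
      have hd := hq d
      have hk1 := hq (k + 1)
      have hd1 := hq (d + 1)
      rw [qP_succ] at hk1 hd1
      have hk2 := right_ne_zero_of_mul hk1
      have hd2 := right_ne_zero_of_mul hd1
      rw [qP_succ q (k + d + 1), qP_succ q k, qP_succ q d]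
      field_simp
      ring

/-- The summand of the fermionic recursion in `ν`. -/
def tq {F : Type*} [Field F] (q : F) (μ s L b : ℕ) (M : ℤ) (n : ℕ) : F :=
  if 2 * n ≤ L then
    q ^ ((s : ℤ) * n + 2 * n * M - (μ + 1) * n ^ 2) *
      qB q ((n : ℤ) + (μ + 1) * L - 2 * M - s - b) n *
      gq q μ (s - 1) (L - 2 * n) (b - 1) (M - (μ + 1) * n)
  else 0

lemma tq_step {F : Type*} [Field F] {q : F} (hq0 : q ≠ 0) (hq : ∀ n, qP q n ≠ 0)
    (μ s L b : ℕ) (hL : 2 ≤ L) (hb : b ≤ μ + 1) (M : ℤ) (n : ℕ) :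
    tq q μ s (L + 1) b M n = tq q μ s (L + 1) (b + 1) M n
      + q ^ (L * (μ + 1 - b)) * tq q μ s L (μ + 1 - b + 1) (M - ((μ + 1 - b : ℕ) : ℤ)) n
      + if n = 0 then 0 else
        q ^ ((μ + 1 : ℤ) * L - b) * tq q μ s (L - 1) b (M - (μ + 1)) (n - 1) := by
  by_cases hn : 2 * n ≤ L + 1
  swap
  · unfold tq
    rw [if_neg hn, if_neg hn, if_neg (by omega), if_neg (by omega : ¬ 2 * (n - 1) ≤ L - 1)]
    simp
  set T : ℤ := (n : ℤ) + (μ + 1) * (L + 1) - 2 * M - s - b with hT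
  set e : ℤ := (s : ℤ) * n + 2 * n * M - (μ + 1) * n ^ 2 with he
  -- second piece
  have hsec : (if n = 0 then 0 else
        q ^ ((μ + 1 : ℤ) * L - b) * tq q μ s (L - 1) b (M - (μ + 1)) (n - 1))
      = q ^ e * (q ^ (T - n) * qB q (T - 1) ((n : ℤ) - 1)) *
        gq q μ (s - 1) (L + 1 - 2 * n) (b - 1) (M - (μ + 1) * n) := by
    rcases Nat.eq_zero_or_pos n with rfl | hn0
    · have : qB q (T - 1) (((0 : ℕ) : ℤ) - 1) = 0 := by
        unfold qB; rw [if_neg]; omega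
      rw [this]; simp
    · obtain ⟨k, rfl⟩ : ∃ k, n = k + 1 := ⟨n - 1, by omega⟩
      obtain ⟨l, rfl⟩ : ∃ l, L = l + 1 := ⟨L - 1, by omega⟩
      rw [if_neg (by omega)]
      unfold tq
      rw [if_pos (by omega)]
      have a1 : l + 1 - 1 - 2 * (k + 1 - 1) = l + 1 + 1 - 2 * (k + 1) := by omega
      have a2 : M - ((μ : ℤ) + 1) - (μ + 1) * ((k + 1 - 1 : ℕ) : ℤ)
          = M - (μ + 1) * ((k + 1 : ℕ) : ℤ) := by
        push_cast [Nat.add_sub_cancel]; ring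
      have a3 : ((k + 1 - 1 : ℕ) : ℤ) + (μ + 1) * ((l + 1 - 1 : ℕ) : ℤ)
          - 2 * (M - (μ + 1)) - s - b = T - 1 := by
        rw [hT]; push_cast [Nat.add_sub_cancel]; ring
      have a4 : ((k + 1 : ℕ) : ℤ) - 1 = ((k + 1 - 1 : ℕ) : ℤ) := by omega
      rw [a1, a2, a3, a4, ← mul_assoc, ← mul_assoc, ← zpow_add₀ hq0, ← mul_assoc, ← zpow_add₀ hq0]
      congr 3
      rw [hT, he]; push_cast [Nat.add_sub_cancel]; ring
  -- first piece
  have hfir : q ^ e * qB q (T - 1) n *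
        gq q μ (s - 1) (L + 1 - 2 * n) (b - 1) (M - (μ + 1) * n)
      = q ^ e * qB q (T - 1) n *
        gq q μ (s - 1) (L + 1 - 2 * n) b (M - (μ + 1) * n)
      + q ^ (L * (μ + 1 - b)) * tq q μ s L (μ + 1 - b + 1) (M - ((μ + 1 - b : ℕ) : ℤ)) n := by
    by_cases hz : T - 1 < n
    · rw [qB_neg _ _ hz]
      unfold tq
      have a3 : (n : ℤ) + (μ + 1) * (L : ℤ) - 2 * (M - ((μ + 1 - b : ℕ) : ℤ)) - s
          - ((μ + 1 - b + 1 : ℕ) : ℤ) = T - 1 := by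
        rw [hT]; push_cast [Nat.cast_sub hb]; ring
      rw [a3, qB_neg _ _ hz]; simp
    · rcases Nat.eq_zero_or_pos b with rfl | hb0
      · have : tq q μ s L (μ + 1 - 0 + 1) (M - ((μ + 1 - 0 : ℕ) : ℤ)) n = 0 := by
          unfold tq
          have : μ + 1 - 0 + 1 - 1 = μ + 1 := by omega
          rw [this, gq_big]; simp
        rw [this]; simp
      · obtain ⟨c, rfl⟩ : ∃ c, b = c + 1 := ⟨b - 1, by omega⟩
        have hc : c ≤ μ := by omega
        have a3 : (n : ℤ) + (μ + 1) * (L : ℤ) - 2 * (M - ((μ + 1 - (c + 1) : ℕ) : ℤ)) - s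
            - ((μ + 1 - (c + 1) + 1 : ℕ) : ℤ) = T - 1 := by
          rw [hT]; push_cast [Nat.cast_sub hb, Nat.cast_sub hc]; ring
        unfold tq
        rw [a3]
        have a5 : μ + 1 - (c + 1) = μ - c := by omega
        simp only [a5, Nat.add_sub_cancel]
        rcases lt_trichotomy (2 * n) L with h1 | h1 | h1
        · rw [if_pos (by omega)]
          obtain ⟨l, hl⟩ : ∃ l, L = l + 1 + 2 * n := ⟨L - 1 - 2 * n, by omega⟩
          have b1 : L + 1 - 2 * n = l + 1 + 1 := by omega
          have b2 : L - 2 * n = l + 1 := by omega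
          rw [b1, b2, gq_rec q μ (s - 1) (l + 1) c (by omega) hc, mul_add]
          congr 1
          have b3 : M - ((μ - c : ℕ) : ℤ) - (μ + 1) * n = M - (μ + 1) * n - ((μ - c : ℕ) : ℤ) := by
            ring
          rw [b3, ← zpow_natCast, ← zpow_natCast, ← mul_assoc, ← mul_assoc, ← mul_assoc,
            ← zpow_add₀ hq0, mul_right_comm (q ^ e), ← zpow_add₀ hq0]
          congr 3
          rw [he, hl]; push_cast [Nat.cast_sub hc]; ring
        · rw [if_pos (by omega)]
          have b1 : L + 1 - 2 * n = 1 := by omega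
          have b2 : L - 2 * n = 0 := by omega
          rw [b1, b2]
          simp only [gq]
          have hL' : (L : ℤ) = 2 * n := by omega
          rw [hL'] at hT
          have c1 : ¬ (s - 1 = 0 ∧ μ - c = 0 ∧ M - ((μ - c : ℕ) : ℤ) - (μ + 1) * n = 0) := by
            rintro ⟨h2, h3, h4⟩
            have : (c : ℤ) = μ := by omega
            rw [h3] at h4
            push_cast at *
            nlinarith
          rw [if_neg c1]
          by_cases hm : M - (μ + 1) * (n : ℤ) = 0
          · have hsum : s + (c + 1) ≤ μ := by
              have : M = (μ + 1) * n := by linarith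
              rw [this] at hT
              push_cast at *
              nlinarith
            rw [if_pos ⟨by omega, hm⟩, if_pos ⟨by omega, hm⟩]; simp
          · rw [if_neg (by tauto), if_neg (by tauto)]; simp
        · rw [if_neg (by omega)]
          have b1 : L + 1 - 2 * n = 0 := by omega
          rw [b1]
          simp only [gq]
          have hL' : (L : ℤ) = 2 * n - 1 := by omega
          rw [hL'] at hT
          have hm : M - (μ + 1) * (n : ℤ) ≠ 0 := by
            intro hm
            have : M = (μ + 1) * n := by linarith
            rw [this] at hT
            push_cast at *
            nlinarith
          rw [if_neg (by tauto), if_neg (by tauto)]; simp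
  have hl : tq q μ s (L + 1) b M n = q ^ e * qB q T n *
      gq q μ (s - 1) (L + 1 - 2 * n) (b - 1) (M - (μ + 1) * n) := by
    unfold tq
    rw [if_pos hn]; push_cast; rfl
  have hl2 : tq q μ s (L + 1) (b + 1) M n = q ^ e * qB q (T - 1) n *
      gq q μ (s - 1) (L + 1 - 2 * n) b (M - (μ + 1) * n) := by
    unfold tq
    rw [if_pos hn]
    have : (n : ℤ) + (μ + 1) * ((L + 1 : ℕ) : ℤ) - 2 * M - s - ((b + 1 : ℕ) : ℤ) = T - 1 := by
      rw [hT]; push_cast; ring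
    rw [this]; rfl
  rw [hsec, hl, hl2, ← hfir]
  by_cases hdeg : T = 0 ∧ n = 0
  · obtain ⟨h0, rfl⟩ := hdeg
    have : gq q μ (s - 1) (L + 1 - 2 * 0) (b - 1) (M - (μ + 1) * ((0 : ℕ) : ℤ)) = 0 := by
      by_contra hne
      have := (gq_supp q μ (s - 1) (L + 1 - 2 * 0) _ _ (by omega) hne).2
      rw [h0] at hT
      have i1 : (s : ℤ) - 1 ≤ ((s - 1 : ℕ) : ℤ) := by omega
      have i2 : (b : ℤ) - 1 ≤ ((b - 1 : ℕ) : ℤ) := by omega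
      push_cast at *
      simp only [mul_zero] at this
      nlinarith
    rw [this]; simp
  · rw [qB_pascal hq T n hdeg]; ring

/-- The sum of the `tq`. -/
def Hq {F : Type*} [Field F] (q : F) (μ s L b N : ℕ) (M : ℤ) : F :=
  ∑ n ∈ Finset.range N, tq q μ s L b M n

lemma Hq_bound {F : Type*} [Field F] (q : F) (μ s L b N N' : ℕ) (M : ℤ)
    (h : L < N) (h' : L < N') : Hq q μ s L b N M = Hq q μ s L b N' M := by
  have key : ∀ N, L < N → Hq q μ s L b N M = Hq q μ s L b (L + 1) M := by
    intro N h
    unfold Hq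
    symm
    apply Finset.sum_subset
    · intro x; simp only [Finset.mem_range]; omega
    · intro x _ hx
      simp only [Finset.mem_range] at hx
      unfold tq; rw [if_neg]; omega
  rw [key N h, key N' h']

lemma Hq_step {F : Type*} [Field F] {q : F} (hq0 : q ≠ 0) (hq : ∀ n, qP q n ≠ 0)
    (μ s L b N : ℕ) (hL : 2 ≤ L) (hb : b ≤ μ + 1) (M : ℤ) (hN : L + 1 < N) :
    Hq q μ s (L + 1) b N M = Hq q μ s (L + 1) (b + 1) N M
      + q ^ (L * (μ + 1 - b)) * Hq q μ s L (μ + 1 - b + 1) N (M - ((μ + 1 - b : ℕ) : ℤ))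
      + q ^ ((μ + 1 : ℤ) * L - b) * Hq q μ s (L - 1) b N (M - (μ + 1)) := by
  rw [Hq_bound q μ s (L - 1) b N (N - 1) _ (by omega) (by omega)]
  unfold Hq
  simp_rw [tq_step hq0 hq μ s L b hL hb M]
  rw [Finset.sum_add_distrib, Finset.sum_add_distrib, Finset.mul_sum, Finset.mul_sum]
  congr 1
  obtain ⟨k, rfl⟩ : ∃ k, N = k + 1 := ⟨N - 1, by omega⟩
  rw [Finset.sum_range_succ']
  simp

lemma Hq_big {F : Type*} [Field F] (q : F) (μ s L N : ℕ) (M : ℤ) :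
    Hq q μ s L (μ + 2) N M = 0 := by
  unfold Hq
  apply Finset.sum_eq_zero
  intro n _
  unfold tq
  have : μ + 2 - 1 = μ + 1 := by omega
  rw [this, gq_big]; simp

lemma gq_two {F : Type*} [Field F] (q : F) (ν s b : ℕ) (m : ℤ) :
    gq q ν s 2 b m = if 0 ≤ m ∧ m + s ≤ ν ∧ m + b ≤ ν then q ^ m else 0 := by
  simp only [gq]
  by_cases h : 0 ≤ m ∧ m + s ≤ ν ∧ m + b ≤ ν
  · rw [if_pos h]
    obtain ⟨k, rfl⟩ : ∃ k : ℕ, m = k := ⟨m.toNat, by omega⟩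
    rw [Finset.sum_eq_single k]
    · rw [if_pos (by omega)]; simp
    · intro j _ hj
      rw [if_neg (by omega)]; simp
    · intro hk; simp only [Finset.mem_range] at hk; omega
  · rw [if_neg h]
    apply Finset.sum_eq_zero
    intro j hj
    simp only [Finset.mem_range] at hj
    rw [if_neg (by omega)]; simp

lemma Hq_one {F : Type*} [Field F] {q : F} (hq : ∀ n, qP q n ≠ 0)
    (μ s b N : ℕ) (M : ℤ) (hN : 1 < N) :
    Hq q μ s 1 b N M = gq q (μ + 1) s 1 b M := by
  rw [Hq_bound q μ s 1 b N 2 _ hN (by omega)]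
  simp only [Hq, Finset.sum_range_succ, Finset.sum_range_zero, tq]
  simp only [gq]
  norm_num
  rw [qB_zero hq]
  simp only [gq]
  by_cases hM : M = 0
  · subst hM
    by_cases h : s + b ≤ μ + 1
    · rw [if_pos (by omega), if_pos (by omega), if_pos (by omega)]; simp
    · rw [if_neg (by omega : ¬ (0 ≤ (μ : ℤ) + 1 - 2 * 0 - s - b))]; simp; omega
  · simp [hM]

lemma Hq_two {F : Type*} [Field F] {q : F} (hq : ∀ n, qP q n ≠ 0)
    (μ s b N : ℕ) (M : ℤ) (hN : 2 < N) (hs : s ≤ μ + 1) (hb : b ≤ μ + 1) :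
    Hq q μ s 2 b N M = gq q (μ + 1) s 2 b M := by
  rw [Hq_bound q μ s 2 b N 3 _ hN (by omega)]
  have e0 : tq q μ s 2 b M 2 = 0 := by simp [tq]
  simp only [Hq, Finset.sum_range_succ, Finset.sum_range_zero, e0]
  have e1 : tq q μ s 2 b M 1 = if s = 0 ∧ b = 0 ∧ M = μ + 1 then q ^ M else 0 := by
    simp only [tq]
    rw [if_pos (by omega), show 2 - 2 * 1 = 0 from rfl]
    simp only [gq]
    by_cases h : s = 0 ∧ b = 0 ∧ M = μ + 1
    · obtain ⟨rfl, rfl, rfl⟩ := h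
      have : (((1 : ℕ) : ℤ) + (μ + 1) * ((2 : ℕ) : ℤ) - 2 * (μ + 1) - ((0 : ℕ) : ℤ)
        - ((0 : ℕ) : ℤ)) = ((1 : ℕ) : ℤ) := by push_cast; ring
      rw [this, qB_self hq]
      rw [if_pos (by simp)]
      simp
      congr 1; ring
    · rw [if_neg h]
      by_cases hM : M = μ + 1
      · rw [qB_neg _ _ (by push_cast; omega)]; simp
      · rw [if_neg (by push_cast; omega)]; simp
  have e2 : tq q μ s 2 b M 0 = if 0 ≤ M ∧ M + (s - 1 : ℕ) ≤ μ ∧ M + (b - 1 : ℕ) ≤ μ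
      then q ^ M else 0 := by
    simp only [tq]
    rw [if_pos (by omega)]
    simp only [Nat.sub_zero, Nat.cast_zero, mul_zero, sub_zero]
    rw [gq_two, qB_zero hq]
    by_cases h : 0 ≤ M ∧ M + (s - 1 : ℕ) ≤ μ ∧ M + (b - 1 : ℕ) ≤ μ
    · rw [if_pos h, if_pos (by push_cast; omega)]; simp
    · rw [if_neg h]; simp
  rw [e1, e2, gq_two]
  by_cases h1 : s = 0 ∧ b = 0 ∧ M = μ + 1
  · rw [if_pos h1, if_neg (by omega), if_pos (by push_cast; omega)]; ring
  · rw [if_neg h1]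
    by_cases h2 : 0 ≤ M ∧ M + (s - 1 : ℕ) ≤ μ ∧ M + (b - 1 : ℕ) ≤ μ
    · rw [if_pos h2, if_pos (by push_cast; omega)]; ring
    · rw [if_neg h2, if_neg (by push_cast; omega)]; ring

lemma Hq_eq {F : Type*} [Field F] {q : F} (hq0 : q ≠ 0) (hq : ∀ n, qP q n ≠ 0)
    (μ s : ℕ) (hs : s ≤ μ + 1) (N : ℕ) (L : ℕ) :
    1 ≤ L → L < N → ∀ b ≤ μ + 2, ∀ M : ℤ, Hq q μ s L b N M = gq q (μ + 1) s L b M := by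
  induction L using Nat.strong_induction_on with
  | _ L ih =>
    intro hL hN b hb
    rcases Nat.lt_or_ge (μ + 1) b with hb' | hb'
    · intro M
      have : b = μ + 1 + 1 := by omega
      subst this
      rw [Hq_big, gq_big]
    rcases Nat.lt_or_ge 2 L with h2 | h2
    swap
    · intro M
      have : L = 1 ∨ L = 2 := by omega
      rcases this with rfl | rfl
      · exact Hq_one hq μ s b N M hN
      · exact Hq_two hq μ s b N M hN hs hb'
    obtain ⟨l, rfl⟩ : ∃ l, L = l + 1 + 1 := ⟨L - 2, by omega⟩
    clear hb'
    obtain ⟨d, hd⟩ : ∃ d, b + d = μ + 2 := ⟨μ + 2 - b, by omega⟩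
    induction d generalizing b with
    | zero =>
      intro M
      have : b = μ + 1 + 1 := by omega
      subst this
      rw [Hq_big, gq_big]
    | succ d ihd =>
      intro M
      have hb1 : b ≤ μ + 1 := by omega
      rw [Hq_step hq0 hq μ s (l + 1) b N (by omega) hb1 M hN,
        ihd (b + 1) (by omega) (by omega) M,
        ih (l + 1) (by omega) (by omega) (by omega) _ (by omega),
        ih (l + 1 - 1) (by omega) (by omega) (by omega) _ (by omega),
        gq_rec q (μ + 1) s (l + 1) b (by omega) hb1, add_assoc]
      congr 1
      have hl : 1 ≤ l := by omega
      rw [gq_rec q (μ + 1) s l (μ + 1 - b) hl (by omega)]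
      have : μ + 1 - (μ + 1 - b) = b := by omega
      rw [this, mul_add, ← mul_assoc, ← pow_add, ← zpow_natCast q ((l + 1) * (μ + 1 - b) + l * b)]
      congr 2
      · congr 1
        push_cast [Nat.cast_sub hb1]; ring
      · congr 1
        push_cast [Nat.cast_sub hb1]; ring

/-! ### The fermionic side -/

lemma NN_snoc {μ : ℕ} (p : Fin μ → ℕ) (n i : ℕ) (hi : i ≤ μ + 1) :
    NN (Fin.snoc p n : Fin (μ + 1) → ℕ) i = NN p i + n := by
  unfold NN
  rw [Fin.sum_univ_castSucc]
  simp [hi]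

lemma NN_top {μ : ℕ} (p : Fin μ → ℕ) : NN p (μ + 1) = 0 := by
  unfold NN
  apply Finset.sum_eq_zero
  intro k _
  rw [if_neg]; omega

lemma le_NN {μ : ℕ} (p : Fin μ → ℕ) (k : Fin μ) (i : ℕ) (hi : i ≤ (k : ℕ) + 1) :
    p k ≤ NN p i := by
  unfold NN
  have := Finset.single_le_sum (f := fun k : Fin μ => if i ≤ (k : ℕ) + 1 then p k else 0)
    (fun _ _ => Nat.zero_le _) (Finset.mem_univ k)
  simpa [hi] using this

lemma expAG_snoc {μ : ℕ} (p : Fin μ → ℕ) (n s : ℕ) (hs : s ≤ μ + 1) :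
    expAG (μ + 1) (μ + 1 - s) (Fin.snoc p n : Fin (μ + 1) → ℕ) =
      expAG μ (μ - (s - 1)) p + 2 * n * (∑ i ∈ Finset.Icc 1 μ, NN p i)
        + (μ + 1) * n ^ 2 + s * n := by
  unfold expAG
  have h1 : ∑ i ∈ Finset.Icc 1 (μ + 1), NN (Fin.snoc p n : Fin (μ + 1) → ℕ) i ^ 2
      = (∑ i ∈ Finset.Icc 1 μ, NN p i ^ 2) + 2 * n * (∑ i ∈ Finset.Icc 1 μ, NN p i)
        + (μ + 1) * n ^ 2 := by
    rw [Finset.sum_congr rfl (g := fun i => NN p i ^ 2 + 2 * n * NN p i + n ^ 2)]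
    · rw [Finset.sum_add_distrib, Finset.sum_add_distrib, ← Finset.mul_sum,
        Finset.sum_Icc_succ_top (by omega), Finset.sum_Icc_succ_top (by omega), NN_top]
      simp
    · intro i hi
      rw [Finset.mem_Icc] at hi
      rw [NN_snoc p n i hi.2]; ring
  have h2 : ∑ i ∈ Finset.Icc (μ + 1 - s + 1) (μ + 1), NN (Fin.snoc p n : Fin (μ + 1) → ℕ) i
      = (∑ i ∈ Finset.Icc (μ - (s - 1) + 1) μ, NN p i) + s * n := by
    rw [Finset.sum_congr rfl (g := fun i => NN p i + n)]
    · rw [Finset.sum_add_distrib]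
      rcases Nat.eq_zero_or_pos s with rfl | h
      · simp
      · have e : μ + 1 - s = μ - (s - 1) := by omega
        rw [e, Finset.sum_Icc_succ_top (by omega), NN_top]
        simp
        left; omega
    · intro i hi
      rw [Finset.mem_Icc] at hi
      rw [NN_snoc p n i hi.2]
  rw [h1, h2]; ring

/-- Summand of `Fpoly`. -/
def frT {F : Type*} [Field F] (q : F) (ν s b : ℕ) (L : ℤ) (nn : Fin ν → ℕ) : F :=
  q ^ expAG ν s nn *
    ∏ i : Fin ν, qB q ((nn i : ℤ) + ((i : ℕ) + 1) * (L : ℤ) -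
      2 * (∑ l ∈ Finset.Icc 1 ((i : ℕ) + 1), (NN nn l : ℤ)) -
      alph ((i : ℕ) + 1) s - alph ((i : ℕ) + 1) b) (nn i)

lemma alph_down (μ s i : ℕ) (hi : i ≤ μ) (hs : s ≤ μ + 1) :
    alph i (μ + 1 - s) = alph i (μ - (s - 1)) := by
  unfold alph; omega

lemma alph_top (μ s : ℕ) (hs : s ≤ μ + 1) :
    alph (μ + 1) (μ + 1 - s) = s := by
  unfold alph; omega

lemma frT_snoc {F : Type*} [Field F] {q : F} (hq0 : q ≠ 0) (μ s b : ℕ) (L M : ℤ)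
    (hs : s ≤ μ + 1) (hb : b ≤ μ + 1) (p : Fin μ → ℕ) (n : ℕ)
    (hM : (∑ i ∈ Finset.Icc 1 μ, (NN p i : ℤ)) = M - (μ + 1) * n) :
    frT q (μ + 1) (μ + 1 - s) (μ + 1 - b) L (Fin.snoc p n : Fin (μ + 1) → ℕ) =
      q ^ ((s : ℤ) * n + 2 * n * M - (μ + 1) * n ^ 2) *
      qB q ((n : ℤ) + (μ + 1) * L - 2 * M - s - b) n *
      frT q μ (μ - (s - 1)) (μ - (b - 1)) (L - 2 * n) p := by
  unfold frT
  rw [expAG_snoc p n s hs, Fin.prod_univ_castSucc]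
  have hsum : ∀ j : ℕ, j ≤ μ + 1 →
      (∑ l ∈ Finset.Icc 1 j, (NN (Fin.snoc p n : Fin (μ + 1) → ℕ) l : ℤ))
      = (∑ l ∈ Finset.Icc 1 j, (NN p l : ℤ)) + j * n := by
    intro j hj
    rw [Finset.sum_congr rfl (g := fun i => (NN p i : ℤ) + n)]
    · rw [Finset.sum_add_distrib]; simp
    · intro i hi
      rw [Finset.mem_Icc] at hi
      rw [NN_snoc p n i (by omega)]; push_cast; ring
  have hlast : qB q (((Fin.snoc p n : Fin (μ + 1) → ℕ) (Fin.last μ) : ℤ)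
      + (((Fin.last μ : Fin (μ + 1)) : ℕ) + 1) * L -
      2 * (∑ l ∈ Finset.Icc 1 (((Fin.last μ : Fin (μ + 1)) : ℕ) + 1),
        (NN (Fin.snoc p n : Fin (μ + 1) → ℕ) l : ℤ)) -
      alph (((Fin.last μ : Fin (μ + 1)) : ℕ) + 1) (μ + 1 - s)
      - alph (((Fin.last μ : Fin (μ + 1)) : ℕ) + 1) (μ + 1 - b))
      ((Fin.snoc p n : Fin (μ + 1) → ℕ) (Fin.last μ))
      = qB q ((n : ℤ) + (μ + 1) * L - 2 * M - s - b) n := by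
    rw [Fin.snoc_last, Fin.val_last, hsum _ le_rfl, alph_top μ s hs, alph_top μ b hb,
      Finset.sum_Icc_succ_top (by omega), NN_top, hM]
    congr 1
    push_cast; ring
  rw [hlast]
  have hprod : ∀ i : Fin μ, qB q (((Fin.snoc p n : Fin (μ + 1) → ℕ) i.castSucc : ℤ)
      + (((i.castSucc : Fin (μ + 1)) : ℕ) + 1) * L -
      2 * (∑ l ∈ Finset.Icc 1 (((i.castSucc : Fin (μ + 1)) : ℕ) + 1),
        (NN (Fin.snoc p n : Fin (μ + 1) → ℕ) l : ℤ)) -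
      alph (((i.castSucc : Fin (μ + 1)) : ℕ) + 1) (μ + 1 - s)
      - alph (((i.castSucc : Fin (μ + 1)) : ℕ) + 1) (μ + 1 - b))
      ((Fin.snoc p n : Fin (μ + 1) → ℕ) i.castSucc)
      = qB q ((p i : ℤ) + ((i : ℕ) + 1) * (L - 2 * n) -
      2 * (∑ l ∈ Finset.Icc 1 ((i : ℕ) + 1), (NN p l : ℤ)) -
      alph ((i : ℕ) + 1) (μ - (s - 1)) - alph ((i : ℕ) + 1) (μ - (b - 1))) (p i) := by
    intro i
    have hi := i.isLt
    rw [Fin.snoc_castSucc, Fin.val_castSucc, hsum _ (by omega),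
      alph_down μ s _ (by omega) hs, alph_down μ b _ (by omega) hb]
    congr 1
    push_cast; ring
  rw [Finset.prod_congr rfl (fun i _ => hprod i)]
  have hexp : q ^ (expAG μ (μ - (s - 1)) p + 2 * n * (∑ i ∈ Finset.Icc 1 μ, NN p i)
        + (μ + 1) * n ^ 2 + s * n)
      = q ^ ((s : ℤ) * n + 2 * n * M - (μ + 1) * n ^ 2) * q ^ expAG μ (μ - (s - 1)) p := by
    rw [← zpow_natCast, ← zpow_natCast, ← zpow_add₀ hq0]
    congr 1
    push_cast
    rw [hM]; ring
  rw [hexp]; ring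

/-- Refined fermionic polynomial. -/
def Fr {F : Type*} [Field F] (q : F) (ν s b : ℕ) (L : ℤ) (Bd : ℕ) (M : ℤ) : F :=
  ∑ nn ∈ Fintype.piFinset (fun _ : Fin ν => Finset.range Bd),
    if (∑ i ∈ Finset.Icc 1 ν, (NN nn i : ℤ)) = M then frT q ν s b L nn else 0

lemma Fr_succ {F : Type*} [Field F] {q : F} (hq0 : q ≠ 0) (μ s b : ℕ) (L M : ℤ) (Bd : ℕ)
    (hs : s ≤ μ + 1) (hb : b ≤ μ + 1) :
    Fr q (μ + 1) (μ + 1 - s) (μ + 1 - b) L Bd M = ∑ n ∈ Finset.range Bd,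
      q ^ ((s : ℤ) * n + 2 * n * M - (μ + 1) * n ^ 2) *
      qB q ((n : ℤ) + (μ + 1) * L - 2 * M - s - b) n *
      Fr q μ (μ - (s - 1)) (μ - (b - 1)) (L - 2 * n) Bd (M - (μ + 1) * n) := by
  unfold Fr
  simp_rw [Finset.mul_sum]
  rw [← Finset.sum_product']
  symm
  apply Finset.sum_equiv (Fin.snocEquiv (fun _ : Fin (μ + 1) => ℕ))
  · rintro ⟨n, p⟩
    simp only [Finset.mem_product, Fintype.mem_piFinset, Fin.snocEquiv, Equiv.coe_fn_mk]
    rw [Fin.forall_fin_succ']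
    simp only [Fin.snoc_castSucc, Fin.snoc_last]
    tauto
  · rintro ⟨n, p⟩ _
    have hE : (Fin.snocEquiv (fun _ : Fin (μ + 1) => ℕ)) (n, p)
      = (Fin.snoc p n : Fin (μ + 1) → ℕ) := rfl
    rw [hE]
    dsimp only
    have hsum : (∑ i ∈ Finset.Icc 1 (μ + 1), (NN (Fin.snoc p n : Fin (μ + 1) → ℕ) i : ℤ))
        = (∑ i ∈ Finset.Icc 1 μ, (NN p i : ℤ)) + (μ + 1) * n := by
      rw [Finset.sum_congr rfl (g := fun i => (NN p i : ℤ) + n)]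
      · rw [Finset.sum_add_distrib, Finset.sum_Icc_succ_top (by omega), NN_top]; simp
      · intro i hi
        rw [Finset.mem_Icc] at hi
        rw [NN_snoc p n i (by omega)]; push_cast; ring
    by_cases h : (∑ i ∈ Finset.Icc 1 μ, (NN p i : ℤ)) = M - (μ + 1) * n
    · rw [if_pos h, if_pos (by rw [hsum, h]; ring)]
      rw [← frT_snoc hq0 μ s b L M hs hb p n h]
    · rw [if_neg h, if_neg (by rw [hsum]; intro h'; apply h; rw [← h']; ring), mul_zero]

lemma Fr_nonneg {F : Type*} [Field F] (q : F) (ν s b : ℕ) (L M : ℤ) (Bd : ℕ)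
    (h : Fr q ν s b L Bd M ≠ 0) : 0 ≤ M := by
  obtain ⟨p, _, hp⟩ := Finset.exists_ne_zero_of_sum_ne_zero h
  by_cases h' : (∑ i ∈ Finset.Icc 1 ν, (NN p i : ℤ)) = M
  · rw [← h']; exact Finset.sum_nonneg (fun _ _ => by positivity)
  · exact absurd (if_neg h') hp

lemma Fr_zero {F : Type*} [Field F] {q : F} (hq : ∀ n, qP q n ≠ 0) (ν : ℕ) (Bd : ℕ)
    (hBd : 0 < Bd) : Fr q ν ν ν 0 Bd 0 = 1 := by
  unfold Fr
  have hNN : ∀ i, NN (fun _ : Fin ν => 0) i = 0 := by intro i; simp [NN]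
  rw [Finset.sum_eq_single (fun _ => 0)]
  · rw [if_pos (by simp [hNN])]
    unfold frT
    have : expAG ν ν (fun _ : Fin ν => 0) = 0 := by simp [expAG, hNN]
    rw [this, pow_zero, one_mul]
    apply Finset.prod_eq_one
    intro i _
    have h2 : alph ((i : ℕ) + 1) ν = 0 := by
      have := i.isLt
      unfold alph; omega
    rw [h2]
    simp only [hNN]
    simp [qB_zero hq]
  · intro p _ hp
    rw [if_neg]
    intro h
    apply hp
    rw [Finset.sum_eq_zero_iff_of_nonneg (fun _ _ => by positivity)] at h
    funext k
    have h1 := h ((k : ℕ) + 1) (by have := k.isLt; rw [Finset.mem_Icc]; omega)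
    have h2 := le_NN p k ((k : ℕ) + 1) le_rfl
    omega
  · intro h
    exfalso; apply h
    simp [Fintype.mem_piFinset, hBd]

lemma gq_nu_zero {F : Type*} [Field F] (q : F) (L : ℕ) (hL : 1 ≤ L) :
    ∀ M : ℤ, gq q 0 0 L 0 M = if M = 0 then 1 else 0 := by
  induction L with
  | zero => omega
  | succ L ih =>
    intro M
    match L with
    | 0 => simp [gq]
    | (l + 1) =>
      simp only [gq]
      simp [ih]

lemma Fr_eq {F : Type*} [Field F] {q : F} (hq0 : q ≠ 0) (hq : ∀ n, qP q n ≠ 0) (ν : ℕ) :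
    ∀ (s b L Bd : ℕ) (M : ℤ), s ≤ ν → b ≤ ν → 1 ≤ L → L < Bd →
      Fr q ν (ν - s) (ν - b) L Bd M = gq q ν s L b M := by
  induction ν with
  | zero =>
    intro s b L Bd M hs hb hL hBd
    have : s = 0 := by omega
    have : b = 0 := by omega
    subst s b
    rw [gq_nu_zero q L hL]
    unfold Fr
    rw [Fintype.piFinset_of_isEmpty]
    simp [frT, expAG, eq_comm]
  | succ μ ih =>
    intro s b L Bd M hs hb hL hBd
    rw [Fr_succ hq0 μ s b L M Bd hs hb,
      ← Hq_eq hq0 hq μ s hs Bd L hL hBd b (by omega) M]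
    unfold Hq
    apply Finset.sum_congr rfl
    intro n _
    unfold tq
    rcases lt_trichotomy (2 * n) L with h | h | h
    · rw [if_pos (by omega)]
      have e : (L : ℤ) - 2 * n = ((L - 2 * n : ℕ) : ℤ) := by omega
      rw [e, ih (s - 1) (b - 1) (L - 2 * n) Bd _ (by omega) (by omega) (by omega) (by omega)]
    · rw [if_pos (by omega)]
      have e : (L : ℤ) - 2 * n = 0 := by omega
      have e' : L - 2 * n = 0 := by omega
      rw [e, e']
      by_cases hneg : (n : ℤ) + (μ + 1) * L - 2 * M - s - b < n
      · rw [qB_neg _ _ hneg]; simp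
      · congr 1
        simp only [gq]
        have hL' : (L : ℤ) = 2 * n := by omega
        rw [hL'] at hneg
        by_cases hm : 0 ≤ M - (μ + 1) * (n : ℤ)
        · have hs0 : s = 0 := by nlinarith
          have hb0 : b = 0 := by nlinarith
          have hm0 : M - (μ + 1) * (n : ℤ) = 0 := by nlinarith
          subst s b
          rw [hm0, if_pos (by simp)]
          exact Fr_zero hq μ Bd (by omega)
        · rw [if_neg (by omega)]
          by_contra hne
          exact hm (Fr_nonneg _ _ _ _ _ _ _ hne)
    · rw [if_neg (by omega)]
      by_cases hm : 0 ≤ M - (μ + 1) * (n : ℤ)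
      · have hneg : (n : ℤ) + (μ + 1) * L - 2 * M - s - b < n := by
          have : (L : ℤ) < 2 * n := by omega
          nlinarith
        rw [qB_neg _ _ hneg]; simp
      · have : Fr q μ (μ - (s - 1)) (μ - (b - 1)) (L - 2 * n) Bd (M - (μ + 1) * n) = 0 := by
          by_contra hne
          exact hm (Fr_nonneg _ _ _ _ _ _ _ hne)
        rw [this, mul_zero]

lemma finsum_Fr {F : Type*} [Field F] (q : F) (ν s b : ℕ) (L : ℤ) (Bd : ℕ) :
    ∑ᶠ M : ℤ, Fr q ν s b L Bd M =
      ∑ nn ∈ Fintype.piFinset (fun _ : Fin ν => Finset.range Bd), frT q ν s b L nn := by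
  unfold Fr
  rw [finsum_sum_comm]
  · apply Finset.sum_congr rfl
    intro nn _
    rw [finsum_eq_single _ (∑ i ∈ Finset.Icc 1 ν, (NN nn i : ℤ))]
    · simp
    · intro M hM
      rw [if_neg hM.symm]
  · intro nn _
    apply (Set.finite_singleton (∑ i ∈ Finset.Icc 1 ν, (NN nn i : ℤ))).subset
    intro M hM
    by_contra h
    exact hM (if_neg (fun h' => h h'.symm))

lemma qB_le {F : Type*} [Field F] {q : F} {T n : ℤ} (h : qB q T n ≠ 0) : n ≤ T := by
  by_contra hlt
  exact h (qB_neg _ _ (not_le.mp hlt))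

lemma Fpoly_eq {F : Type*} [Field F] (q : F) (ν s b L : ℕ) (hν : 1 ≤ ν) :
    Fpoly ν s b L q =
      ∑ nn ∈ Fintype.piFinset (fun _ : Fin ν => Finset.range (L + 1)), frT q ν s b L nn := by
  unfold Fpoly
  apply finsum_eq_sum_of_support_subset
  intro nn hnn
  have h := right_ne_zero_of_mul hnn
  rw [Finset.prod_ne_zero_iff] at h
  have h0 := h ⟨0, hν⟩ (Finset.mem_univ _)
  have h1 := qB_le h0
  have a1 : 0 ≤ alph (0 + 1) s := by unfold alph; omega
  have a2 : 0 ≤ alph (0 + 1) b := by unfold alph; omega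
  simp only [Nat.cast_zero, zero_add, Finset.Icc_self, Finset.sum_singleton] at h1 a1 a2
  simp only [Finset.mem_coe, Fintype.mem_piFinset, Finset.mem_range]
  intro k
  have := le_NN nn k 1 (by omega)
  omega

/-! ### The Gordon path side -/

/-- Recursive enumeration of Gordon paths. -/
def GP (ν s : ℕ) : ℕ → ℕ → Finset (ℕ → ℕ)
  | 0, _ => ∅
  | 1, b => if s + b ≤ ν then {fun k => if k = 0 then s else if k = 1 then b else 0} else ∅
  | (L + 2), b => (Finset.range (ν + 1 - b)).biUnion fun k =>
      (GP ν s (L + 1) k).image fun f => Function.update f (L + 2) b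

lemma mem_GP (ν s L : ℕ) (hL : 1 ≤ L) : ∀ (b : ℕ) (f : ℕ → ℕ), b ≤ ν →
    (f ∈ GP ν s L b ↔ IsGordon ν L s b f) := by
  induction L with
  | zero => omega
  | succ L ih =>
    intro b f hb
    match L with
    | 0 =>
      simp only [GP, IsGordon, zero_add]
      constructor
      · intro h
        split_ifs at h with hsb
        · rw [Finset.mem_singleton] at h
          subst h
          refine ⟨by simp, by simp, ?_, ?_⟩
          · intro k hk
            have : k = 0 := by omega
            subst this; simpa using hsb
          · intro k hk
            dsimp only
            rw [if_neg (by omega), if_neg (by omega)]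
        · simp at h
      · rintro ⟨h0, h1, h2, h3⟩
        have := h2 0 (by omega)
        simp only [zero_add, h0, h1] at this
        rw [if_pos this, Finset.mem_singleton]
        funext k
        by_cases hk0 : k = 0
        · subst hk0; simp [h0]
        · by_cases hk1 : k = 1
          · subst hk1; simp [h1]
          · rw [if_neg hk0, if_neg hk1]; exact h3 k (by omega)
    | (l + 1) =>
      simp only [GP, Finset.mem_biUnion, Finset.mem_image, Finset.mem_range]
      constructor
      · rintro ⟨k, hk, f', hf', rfl⟩
        obtain ⟨h0, h1, h2, h3⟩ := (ih (by omega) k f' (by omega)).1 hf'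
        refine ⟨?_, ?_, ?_, ?_⟩
        · rw [Function.update_of_ne (by omega)]; exact h0
        · rw [Function.update_self]
        · intro j hj
          by_cases hj' : j = l + 1
          · subst hj'
            rw [Function.update_of_ne (by omega), Function.update_self, h1]; omega
          · rw [Function.update_of_ne (by omega), Function.update_of_ne (by omega)]
            exact h2 j (by omega)
        · intro j hj
          rw [Function.update_of_ne (by omega)]
          exact h3 j (by omega)
      · rintro ⟨h0, h1, h2, h3⟩
        have hlast := h2 (l + 1) (by omega)
        rw [h1] at hlast
        refine ⟨f (l + 1), by omega, Function.update f (l + 2) 0, ?_, ?_⟩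
        · rw [ih (by omega) _ _ (by omega)]
          refine ⟨?_, ?_, ?_, ?_⟩
          · rw [Function.update_of_ne (by omega)]; exact h0
          · rw [Function.update_of_ne (by omega)]
          · intro j hj
            rw [Function.update_of_ne (by omega), Function.update_of_ne (by omega)]
            exact h2 j (by omega)
          · intro j hj
            by_cases hj' : j = l + 2
            · subst hj'; rw [Function.update_self]
            · rw [Function.update_of_ne hj']; exact h3 j (by omega)
        · rw [Function.update_idem, ← h1, Function.update_eq_self]

lemma gq_finite {F : Type*} [Field F] (q : F) (ν s L b : ℕ) (hL : 1 ≤ L) :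
    (Function.support (gq q ν s L b)).Finite := by
  apply (Set.finite_Icc (0 : ℤ) ((ν : ℤ) * L)).subset
  intro m hm
  have := gq_supp q ν s L b m hL hm
  simp only [Set.mem_Icc]
  constructor
  · exact this.1
  · linarith [this.2, this.1, (by positivity : (0 : ℤ) ≤ s), (by positivity : (0 : ℤ) ≤ b)]

lemma sum_GP {F : Type*} [Field F] {q : F} (hq0 : q ≠ 0) (ν s L : ℕ) (hL : 1 ≤ L) :
    ∀ b ≤ ν, ∑ f ∈ GP ν s L b, q ^ gwt 0 L f = ∑ᶠ m : ℤ, gq q ν s L b m := by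
  induction L with
  | zero => omega
  | succ L ih =>
    intro b hb
    match L with
    | 0 =>
      simp only [GP, gq, zero_add]
      rw [finsum_eq_single _ 0 (fun m hm => if_neg (by tauto))]
      by_cases h : s + b ≤ ν
      · rw [if_pos h, if_pos ⟨h, rfl⟩, Finset.sum_singleton]
        have : Finset.Ioo 0 1 = (∅ : Finset ℕ) := by ext x; simp; omega
        simp [gwt, this]
      · rw [if_neg h, if_neg (by tauto)]; simp
    | (l + 1) =>
      simp only [GP, gq]
      rw [finsum_sum_comm]
      · rw [Finset.sum_biUnion]
        · apply Finset.sum_congr rfl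
          intro k hk
          rw [Finset.mem_range] at hk
          have hshift : ∑ᶠ a : ℤ, gq q ν s (l + 1) k (a - k) = ∑ᶠ a : ℤ, gq q ν s (l + 1) k a :=
            finsum_comp_equiv (Equiv.subRight (k : ℤ)) (f := gq q ν s (l + 1) k)
          rw [← mul_finsum, hshift, ← ih (by omega) k (by omega), Finset.mul_sum, Finset.sum_image]
          · apply Finset.sum_congr rfl
            intro f hf
            rw [mem_GP ν s (l + 1) (by omega) k f (by omega)] at hf
            rw [← zpow_natCast, ← zpow_add₀ hq0]
            congr 1
            unfold gwt
            have : Finset.Ioo 0 (l + 1 + 1) = insert (l + 1) (Finset.Ioo 0 (l + 1)) := by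
              ext x; simp only [Finset.mem_Ioo, Finset.mem_insert]; omega
            rw [this, Finset.sum_insert (by simp), Function.update_of_ne (by omega), hf.2.1]
            congr 1
            · push_cast; ring
            · apply Finset.sum_congr rfl
              intro x hx
              rw [Finset.mem_Ioo] at hx
              rw [Function.update_of_ne (by omega)]
          · intro f hf g hg hfg
            have hf := (mem_GP ν s (l + 1) (by omega) k f (by omega)).1 hf
            have hg := (mem_GP ν s (l + 1) (by omega) k g (by omega)).1 hg
            funext x
            by_cases hx : x = l + 2
            · subst hx
              rw [hf.2.2.2 _ (by omega), hg.2.2.2 _ (by omega)]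
            · have := congrFun hfg x
              simpa [Function.update_of_ne hx] using this
        · intro i hi j hj hij
          simp only [Finset.coe_range, Set.mem_Iio] at hi hj
          change Disjoint _ _
          rw [Finset.disjoint_left]
          intro f hf hf'
          rw [Finset.mem_image] at hf hf'
          obtain ⟨f1, h1, rfl⟩ := hf
          obtain ⟨f2, h2, h3⟩ := hf'
          have h1 := (mem_GP ν s (l + 1) (by omega) i f1 (by omega)).1 h1
          have h2 := (mem_GP ν s (l + 1) (by omega) j f2 (by omega)).1 h2
          have := congrFun h3 (l + 1)
          rw [Function.update_of_ne (by omega), Function.update_of_ne (by omega),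
            h1.2.1, h2.2.1] at this
          exact hij this.symm
      · intro k _
        have h := gq_finite q ν s (l + 1) k (by omega)
        have h' := h.preimage (Equiv.subRight (k : ℤ)).injective.injOn
        apply h'.subset
        intro m hm
        exact right_ne_zero_of_mul hm

lemma G_eq {F : Type*} [Field F] {q : F} (hq0 : q ≠ 0) (ν s L b : ℕ) (hL : 1 ≤ L) (hb : b ≤ ν) :
    G ν 0 (L : ℤ) s b q = ∑ᶠ m : ℤ, gq q ν s L b m := by
  rw [← sum_GP hq0 ν s L hL b hb]
  unfold G
  have e : ((L : ℤ) - 0).toNat = L := by omega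
  rw [e, finsum_eq_sum_of_support_subset (s := GP ν s L b)]
  · apply Finset.sum_congr rfl
    intro f hf
    rw [if_pos ((mem_GP ν s L hL b f hb).1 hf)]
  · intro f hf
    rw [Finset.mem_coe, mem_GP ν s L hL b f hb]
    by_contra h
    exact hf (if_neg h)

lemma qP_X_ne (n : ℕ) : qP (RatFunc.X : RatFunc ℚ) n ≠ 0 := by
  unfold qP
  rw [Finset.prod_ne_zero_iff]
  intro j _ h
  have h1 : algebraMap (Polynomial ℚ) (RatFunc ℚ) (1 - Polynomial.X ^ (j + 1)) = 0 := by
    rw [map_sub, map_pow, map_one, RatFunc.algebraMap_X]; exact h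
  have h2 := (map_eq_zero_iff _ (RatFunc.algebraMap_injective ℚ)).1 h1
  have h3 := congrArg (Polynomial.eval 0) h2
  simp at h3

theorem stmt_13 (ν : ℕ) (hν : 1 ≤ ν) (s b : ℕ) (hs : s ≤ ν) (hb : b ≤ ν) (L : ℕ) (hL : 2 ≤ L) :
    G ν 0 (L : ℤ) s b (RatFunc.X : K) = Fpoly ν (ν - s) (ν - b) L RatFunc.X := by
  have hq0 : (RatFunc.X : K) ≠ 0 := RatFunc.X_ne_zero
  rw [G_eq hq0 ν s L b (by omega) hb, Fpoly_eq _ ν _ _ L hν, ← finsum_Fr]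
  apply finsum_congr
  intro M
  exact (Fr_eq hq0 qP_X_ne ν s b L (L + 1) M hs hb (by omega) (by omega)).symm

end
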